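/- For every point-shift F and μ-almost every ω, a connected component of the functional graph G^F(ω) contains a directed cycle if and only if it is finite. Consequently, G^F(ω) is μ-almost surely acyclic if and only if it μ-almost surely has no finite connected component. -/

import Mathlib

open Function Set MeasureTheory ProbabilityTheory
open scoped ENNReal NNReal

namespace PointShift

/-- Points of the grid `ℤ^d`. -/
abbrev Pt (d : ℕ) := Fin d → ℤ

/-- Configurations: subsets of the grid `ℤ^d`, identified with `{0,1}`-valued
functions, equipped with the product σ-algebra. -/
abbrev Conf (d : ℕ) := Pt d → Bool

/-- The shift `θ_t ω = ω - t`. -/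
def shift {d : ℕ} (t : Pt d) (ω : Conf d) : Conf d := fun x => ω (x + t)

/-- The support of a configuration, as a subset of `ℤ^d`. -/
def pts {d : ℕ} (ω : Conf d) : Set (Pt d) := {x | ω x = true}

/-- `g` is a point-map: it is measurable and selects a point of every
configuration having a point at the origin. -/
def IsPointMap {d : ℕ} (g : Conf d → Pt d) : Prop :=
  Measurable g ∧ ∀ ω : Conf d, ω 0 = true → ω (g ω) = true

/-- The point-shift associated with a point-map `g`: `F_ω x = x + g (θ_x ω)`. -/
def Fps {d : ℕ} (g : Conf d → Pt d) (ω : Conf d) (x : Pt d) : Pt d :=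
  x + g (shift x ω)

/-- `μ` is a stationary point process on the grid: a shift-invariant probability
measure with a point at the origin with positive probability. -/
def IsStationaryPP {d : ℕ} (μ : Measure (Conf d)) : Prop :=
  IsProbabilityMeasure μ ∧ (∀ t : Pt d, μ.map (shift t) = μ) ∧
    0 < μ {ω : Conf d | ω 0 = true}

/-- The Palm probability of `μ`: `μ` conditioned on having a point at the origin. -/
noncomputable def Palm {d : ℕ} (μ : Measure (Conf d)) : Measure (Conf d) :=
  μ[|{ω : Conf d | ω 0 = true}]

/-- The foil of the point `x` in the configuration `ω`, for the point-shift of `g`. -/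
def foilOn {d : ℕ} (g : Conf d → Pt d) (ω : Conf d) (x : Pt d) : Set (Pt d) :=
  {y | ω y = true ∧ ∃ n : ℕ, (Fps g ω)^[n] y = (Fps g ω)^[n] x}

/-- The connected component of the point `x` in the functional graph `G^F(ω)`. -/
def compOn {d : ℕ} (g : Conf d → Pt d) (ω : Conf d) (x : Pt d) : Set (Pt d) :=
  {y | ω y = true ∧ ∃ m n : ℕ, (Fps g ω)^[m] x = (Fps g ω)^[n] y}

/-- `K` is a directed cycle of the functional graph of `f`: a finite set of
distinct points `c 0, …, c (k-1)` (with `k ≥ 1`) such that `f (c i) = c ((i+1) % k)`. -/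
def IsCycle {X : Type*} (f : X → X) (K : Set X) : Prop :=
  ∃ (k : ℕ) (c : ℕ → X), 0 < k ∧
    (∀ i < k, ∀ j < k, c i = c j → i = j) ∧
    (∀ i < k, f (c i) = c ((i + 1) % k)) ∧
    K = c '' {i | i < k}

end PointShift

namespace PointShift

section FunctionalGraph

variable {X : Type*} {f : X → X}

/-- `z` is the first periodic point on the forward orbit of `y`. -/
def IsFirstPeriodic (f : X → X) (y z : X) : Prop :=
  ∃ n : ℕ, f^[n] y = z ∧ f^[n] y ∈ periodicPts f ∧ ∀ m < n, f^[m] y ∉ periodicPts f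

theorem IsFirstPeriodic.unique {y z w : X} (hz : IsFirstPeriodic f y z)
    (hw : IsFirstPeriodic f y w) : z = w := by
  obtain ⟨n, rfl, hn, hn'⟩ := hz
  obtain ⟨m, rfl, hm, hm'⟩ := hw
  rcases lt_trichotomy n m with h | rfl | h
  · exact absurd hn (hm' n h)
  · rfl
  · exact absurd hm (hn' m h)

theorem finite_range_iterate_of_mem_periodicPts {z : X} (hz : z ∈ periodicPts f) :
    (range fun i : ℕ => f^[i] z).Finite := by
  obtain ⟨k, hk, hkz⟩ := hz
  refine ((finite_Iio k).image fun i => f^[i] z).subset ?_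
  rintro _ ⟨i, rfl⟩
  exact ⟨i % k, Nat.mod_lt _ hk, hkz.iterate_mod_apply i⟩

/-- A point that eventually joins the orbit of a periodic point `z` has its first periodic point
on that orbit. -/
theorem exists_isFirstPeriodic {y z : X} (hz : z ∈ periodicPts f) {a b : ℕ}
    (h : f^[a] y = f^[b] z) : ∃ i : ℕ, IsFirstPeriodic f y (f^[i] z) := by
  classical
  have hbz : f^[b] z ∈ periodicPts f := by
    obtain ⟨k, hk, hkz⟩ := hz
    exact ⟨k, hk, hkz.apply_iterate b⟩
  have hex : ∃ n, f^[n] y ∈ periodicPts f := ⟨a, h ▸ hbz⟩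
  set N := Nat.find hex with hN
  have hNa : N ≤ a := Nat.find_min' hex (h ▸ hbz)
  obtain ⟨c, rfl⟩ := Nat.exists_eq_add_of_le hNa
  obtain ⟨k, hk, hkp⟩ := Nat.find_spec hex
  obtain ⟨j, hj⟩ : ∃ j, j + c = k * c :=
    ⟨k * c - c, Nat.sub_add_cancel (Nat.le_mul_of_pos_left c hk)⟩
  have hback : f^[j + b] z = f^[N] y := by
    rw [iterate_add_apply, ← h, add_comm N c, iterate_add_apply f c, ← iterate_add_apply f j, hj]
    exact hkp.mul_const c
  exact ⟨j + b, N, hback.symm, Nat.find_spec hex, fun m hm => Nat.find_min hex hm⟩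

theorem IsCycle.exists_mem_periodicPts {K : Set X} (hK : IsCycle f K) :
    ∃ z ∈ K, z ∈ periodicPts f := by
  obtain ⟨k, c, hk, -, hc, rfl⟩ := hK
  have hit : ∀ i, f^[i] (c 0) = c (i % k) := by
    intro i
    induction i with
    | zero => simp
    | succ i ih => rw [iterate_succ_apply', ih, hc _ (Nat.mod_lt _ hk), Nat.mod_add_mod]
  refine ⟨c 0, ⟨0, hk, rfl⟩, k, hk, ?_⟩
  rw [IsPeriodicPt, IsFixedPt, hit, Nat.mod_self]

theorem isCycle_of_mem_periodicPts {z : X} (hz : z ∈ periodicPts f) :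
    IsCycle f ((fun i => f^[i] z) '' {i | i < minimalPeriod f z}) := by
  refine ⟨minimalPeriod f z, fun i => f^[i] z, minimalPeriod_pos_of_mem_periodicPts hz, ?_, ?_, rfl⟩
  · intro i hi j hj h
    exact (iterate_injOn_Iio_minimalPeriod (f := f) (x := z)) hi hj h
  · intro i _
    beta_reduce
    rw [iterate_mod_minimalPeriod_eq, iterate_succ_apply']

end FunctionalGraph

variable {d : ℕ}

theorem measurable_shift (t : Pt d) : Measurable (shift t : Conf d → Conf d) :=
  measurable_pi_lambda _ fun x => measurable_pi_apply (x + t)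

theorem measurable_shift_prod : Measurable fun p : Conf d × Pt d => shift p.2 p.1 :=
  measurable_from_prod_countable_left measurable_shift

theorem measurable_iterate_Fps {g : Conf d → Pt d} (hg : Measurable g) (n : ℕ) (x : Pt d) :
    Measurable fun ω => (Fps g ω)^[n] x := by
  induction n with
  | zero => exact measurable_const
  | succ n ih =>
    simp only [iterate_succ_apply', Fps]
    exact ih.add (hg.comp (measurable_shift_prod.comp (measurable_id.prodMk ih)))

theorem Fps_shift (g : Conf d → Pt d) (ω : Conf d) (t x : Pt d) :
    Fps g (shift t ω) x + t = Fps g ω (x + t) := by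
  have : shift x (shift t ω) = shift (x + t) ω := by
    funext y
    simp only [shift, add_assoc]
  rw [Fps, Fps, this]
  abel

theorem iterate_Fps_shift (g : Conf d → Pt d) (ω : Conf d) (t : Pt d) (n : ℕ) (x : Pt d) :
    (Fps g (shift t ω))^[n] x + t = (Fps g ω)^[n] (x + t) := by
  induction n with
  | zero => rfl
  | succ n ih => rw [iterate_succ_apply', iterate_succ_apply', Fps_shift, ih]

theorem mem_periodicPts_Fps_shift (g : Conf d → Pt d) (ω : Conf d) (t x : Pt d) :
    x ∈ periodicPts (Fps g (shift t ω)) ↔ x + t ∈ periodicPts (Fps g ω) := by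
  simp only [periodicPts, mem_ofPred_eq, IsPeriodicPt, IsFixedPt, ← iterate_Fps_shift,
    add_left_inj]

theorem isFirstPeriodic_Fps_shift (g : Conf d → Pt d) (ω : Conf d) (t y z : Pt d) :
    IsFirstPeriodic (Fps g (shift t ω)) y z ↔ IsFirstPeriodic (Fps g ω) (y + t) (z + t) := by
  simp only [IsFirstPeriodic, mem_periodicPts_Fps_shift, ← iterate_Fps_shift,
    add_left_inj]

theorem measurableSet_isFirstPeriodic {g : Conf d → Pt d} (hg : Measurable g) (y z : Pt d) :
    MeasurableSet {ω | IsFirstPeriodic (Fps g ω) y z} := by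
  have heq : ∀ m n w, Measurable fun ω => (Fps g ω)^[m] y = (Fps g ω)^[n] w := fun m n w =>
    measurableSet_setOfPred.1
      (measurableSet_eq_fun (measurable_iterate_Fps hg m y) (measurable_iterate_Fps hg n w))
  have hper : ∀ n, Measurable fun ω => (Fps g ω)^[n] y ∈ periodicPts (Fps g ω) := by
    intro n
    simp only [periodicPts, mem_ofPred_eq, IsPeriodicPt, IsFixedPt, ← iterate_add_apply]
    exact .exists fun k => measurable_const.and (heq _ _ _)
  exact measurableSet_setOfPred.2 <| .exists fun n => (heq n 0 z).and <|
    (hper n).and <| .forall fun m => .forall fun _ => (hper m).not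

/-- Mass transport: almost surely only finitely many points have a given first periodic point. -/
theorem ae_finite_isFirstPeriodic {μ : Measure (Conf d)} [IsProbabilityMeasure μ]
    (hinv : ∀ t : Pt d, μ.map (shift t) = μ) {g : Conf d → Pt d} (hg : Measurable g) :
    ∀ᵐ ω ∂μ, ∀ z, {y | IsFirstPeriodic (Fps g ω) y z}.Finite := by
  rw [ae_all_iff]
  intro z
  have htrans : ∀ y, μ {ω | IsFirstPeriodic (Fps g ω) y z} =
      μ {ω | IsFirstPeriodic (Fps g ω) z (z + z - y)} := by
    intro y
    conv_lhs => rw [← hinv (z - y),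
      Measure.map_apply (measurable_shift _) (measurableSet_isFirstPeriodic hg y z)]
    simp only [preimage_ofPred_eq, isFirstPeriodic_Fps_shift, add_sub_cancel, add_sub_assoc]
  have hsum : ∑' y, μ {ω | IsFirstPeriodic (Fps g ω) y z} ≠ ∞ := by
    simp only [htrans]
    refine ((Equiv.subLeft (z + z)).tsum_eq fun w =>
      μ {ω | IsFirstPeriodic (Fps g ω) z w}).trans_ne ?_
    rw [← measure_iUnion _ fun w => measurableSet_isFirstPeriodic hg z w]
    · exact measure_ne_top _ _
    · intro v w hvw
      exact Set.disjoint_left.2 fun ω hv hw => hvw (IsFirstPeriodic.unique hv hw)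
  exact ae_finite_setOfPred_mem hsum

theorem iterate_Fps_mem {g : Conf d → Pt d} (hg : ∀ ω : Conf d, ω 0 = true → ω (g ω) = true)
    {ω : Conf d} {x : Pt d} (hx : ω x = true) (n : ℕ) : ω ((Fps g ω)^[n] x) = true := by
  induction n with
  | zero => exact hx
  | succ n ih =>
    rw [iterate_succ_apply', Fps, add_comm]
    exact hg (shift _ ω) (by simpa [shift] using ih)

theorem exists_isCycle_subset_compOn_of_finite {g : Conf d → Pt d}
    (hg : ∀ ω : Conf d, ω 0 = true → ω (g ω) = true) {ω : Conf d} {x : Pt d} (hx : ω x = true)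
    (hfin : (compOn g ω x).Finite) : ∃ K, IsCycle (Fps g ω) K ∧ K ⊆ compOn g ω x := by
  have hmem : ∀ n, (Fps g ω)^[n] x ∈ compOn g ω x := fun n =>
    ⟨iterate_Fps_mem hg hx n, n, 0, rfl⟩
  obtain ⟨i, j, hij, h⟩ := hfin.exists_lt_map_eq_of_forall_mem hmem
  obtain ⟨k, rfl⟩ := Nat.exists_eq_add_of_lt hij
  have hper : (Fps g ω)^[i] x ∈ periodicPts (Fps g ω) := by
    refine ⟨k + 1, Nat.succ_pos k, ?_⟩
    rw [IsPeriodicPt, IsFixedPt, ← iterate_add_apply, h]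
    congr 1
    omega
  refine ⟨_, isCycle_of_mem_periodicPts hper, ?_⟩
  rintro _ ⟨l, -, rfl⟩
  simp only [← iterate_add_apply]
  exact hmem _

theorem finite_compOn_of_isCycle {g : Conf d → Pt d} {ω : Conf d} {x : Pt d}
    (hfin : ∀ z, {y | IsFirstPeriodic (Fps g ω) y z}.Finite) {K : Set (Pt d)}
    (hK : IsCycle (Fps g ω) K) (hKx : K ⊆ compOn g ω x) : (compOn g ω x).Finite := by
  obtain ⟨z, hzK, hz⟩ := hK.exists_mem_periodicPts
  obtain ⟨-, a, b, hab⟩ := hKx hzK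
  refine ((finite_range_iterate_of_mem_periodicPts hz).biUnion fun p _ => hfin p).subset ?_
  rintro y ⟨-, m, n, hmn⟩
  have h : (Fps g ω)^[a + n] y = (Fps g ω)^[m + b] z := by
    rw [iterate_add_apply, ← hmn, ← iterate_add_apply, add_comm, iterate_add_apply, hab,
      ← iterate_add_apply]
  obtain ⟨i, hi⟩ := exists_isFirstPeriodic hz h
  exact mem_biUnion (mem_range_self i) hi

end PointShift

/-- For `μ`-almost every `ω`, a connected component of `G^F(ω)`
contains a directed cycle iff it is finite; consequently `G^F(ω)` is almost surely
acyclic iff it almost surely has no finite connected component. -/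
theorem stmt_10 {d : ℕ} (hd : 0 < d)
    (μ : Measure (PointShift.Conf d)) [IsProbabilityMeasure μ]
    (hinv : ∀ t : PointShift.Pt d, μ.map (PointShift.shift t) = μ)
    (hpos : 0 < μ {ω : PointShift.Conf d | ω 0 = true})
    (g : PointShift.Conf d → PointShift.Pt d) (hg : PointShift.IsPointMap g) :
    (∀ᵐ ω ∂μ, ∀ x : PointShift.Pt d, ω x = true →
      ((∃ K : Set (PointShift.Pt d), PointShift.IsCycle (PointShift.Fps g ω) K ∧
          K ⊆ PointShift.compOn g ω x) ↔ (PointShift.compOn g ω x).Finite)) ∧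
    ((∀ᵐ ω ∂μ, ¬ ∃ x : PointShift.Pt d, ω x = true ∧
        ∃ K : Set (PointShift.Pt d), PointShift.IsCycle (PointShift.Fps g ω) K ∧
          K ⊆ PointShift.compOn g ω x) ↔
      (∀ᵐ ω ∂μ, ∀ x : PointShift.Pt d, ω x = true →
        (PointShift.compOn g ω x).Infinite)) := by
  have key : ∀ᵐ ω ∂μ, ∀ x : PointShift.Pt d, ω x = true →
      ((∃ K : Set (PointShift.Pt d), PointShift.IsCycle (PointShift.Fps g ω) K ∧
          K ⊆ PointShift.compOn g ω x) ↔ (PointShift.compOn g ω x).Finite) := by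
    filter_upwards [PointShift.ae_finite_isFirstPeriodic hinv hg.1] with ω hω x hx
    exact ⟨fun ⟨_, hK, hKx⟩ => PointShift.finite_compOn_of_isCycle hω hK hKx,
      PointShift.exists_isCycle_subset_compOn_of_finite hg.2 hx⟩
  refine ⟨key, Filter.eventually_congr ?_⟩
  filter_upwards [key] with ω hω
  rw [not_exists]
  refine forall_congr' fun x => ?_
  rw [not_and]
  exact forall_congr' fun hx => not_congr (hω x hx)
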